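/- arXiv:2605.10549 — 3 statements merged into one kernel-verified Lean document; each statement's English description precedes it below -/
import Mathlib

section
/- Every monomial polynomial vector field of total coefficient degree at least 4 is a bracket of vector fields with vanishing 1-jet: for all natural numbers m, n with m + n ≥ 4 and each i ∈ {1,2}, the derivation (z¹)ᵐ(z²)ⁿ∂ᵢ of ℂ[z¹,z²] can be written as a bracket ⁅X, Y⁆ with X, Y ∈ L₁, where L₁ is the Lie algebra of polynomial vector fields f₁∂₁ + f₂∂₂ with f₁, f₂ ∈ (z¹,z²)². -/
open MvPolynomial

noncomputable section

/-- The polynomial ring `ℂ[z¹,z²]`. -/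
abbrev R2 : Type := MvPolynomial (Fin 2) ℂ

/-- The Lie algebra of ℂ-linear derivations of `ℂ[z¹,z²]`. -/
abbrev W2 : Type := Derivation ℂ R2 R2

def z1 : R2 := X 0
def z2 : R2 := X 1

/-- The partial-derivative derivations `∂₁, ∂₂`. -/
def d (i : Fin 2) : W2 := pderiv i

/-- The maximal ideal `(z¹, z²)` of `ℂ[z¹,z²]`. -/
def I2 : Ideal R2 := Ideal.span {z1, z2}

/-- The set `L₁` of polynomial vector fields `f₁∂₁ + f₂∂₂` with vanishing
1-jet, i.e. with `f₁, f₂ ∈ (z¹,z²)²`. -/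
def L1 : Set W2 :=
  {D | ∃ f₁ f₂ : R2, f₁ ∈ I2 ^ 2 ∧ f₂ ∈ I2 ^ 2 ∧ D = f₁ • d 0 + f₂ • d 1}

theorem smul_d_mem_L1 {f : R2} (hf : f ∈ I2 ^ 2) (i : Fin 2) : f • d i ∈ L1 := by
  fin_cases i
  · exact ⟨f, 0, hf, zero_mem _, by simp⟩
  · exact ⟨0, f, zero_mem _, hf, by simp⟩

theorem X_mem_I2 (i : Fin 2) : (X i : R2) ∈ I2 := by
  fin_cases i
  · exact Ideal.subset_span (by simp [z1])
  · exact Ideal.subset_span (by simp [z2])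

theorem monomial_mem_I2_sq (i j : Fin 2) {a b : ℕ} (h : 2 ≤ a + b) :
    (X i ^ a * X j ^ b : R2) ∈ I2 ^ 2 := by
  refine Ideal.pow_le_pow_right h ?_
  rw [pow_add]
  exact Ideal.mul_mem_mul (Ideal.pow_mem_pow (X_mem_I2 i) a) (Ideal.pow_mem_pow (X_mem_I2 j) b)

theorem lie_smul_d (f g : R2) (i : Fin 2) :
    ⁅f • d i, g • d i⁆ = (f * pderiv i g - g * pderiv i f) • d i := by
  ext1 k
  simp only [Derivation.commutator_apply, Derivation.smul_apply, smul_eq_mul, d,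
    Derivation.leibniz, pderiv_X]
  by_cases hk : k = i
  · subst hk
    simp
  · simp [hk]

/-- A nonzero multiple of `p∂ᵢ` that is a bracket of `f∂ᵢ` and `g∂ᵢ` can be normalised. -/
theorem exists_lie_of_wronskian {f g p : R2} {i : Fin 2} {k : ℕ} (hf : f ∈ I2 ^ 2)
    (hg : g ∈ I2 ^ 2) (hk : k ≠ 0) (h : f * pderiv i g - g * pderiv i f = k * p) :
    ∃ X ∈ L1, ∃ Y ∈ L1, p • d i = ⁅X, Y⁆ := by
  refine ⟨_, smul_d_mem_L1 hf i, _, smul_d_mem_L1 (Ideal.mul_mem_left _ (C (k : ℂ)⁻¹) hg) i, ?_⟩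
  rw [lie_smul_d, pderiv_C_mul]
  congr 1
  have hC : C (k : ℂ)⁻¹ * (k : R2) = 1 := by
    rw [← map_natCast (C : ℂ →+* R2), ← C_mul, inv_mul_cancel₀ (Nat.cast_ne_zero.mpr hk), C_1]
  linear_combination (-p) * hC - C (k : ℂ)⁻¹ * h

theorem exists_lie_eq_monomial_smul_d {i j : Fin 2} (hij : j ≠ i) (m n : ℕ) (h : 4 ≤ m + n) :
    ∃ D ∈ L1, ∃ E ∈ L1, (X i ^ m * X j ^ n : R2) • d i = ⁅D, E⁆ := by
  have hj : pderiv i (X j : R2) = 0 := pderiv_X_of_ne hij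
  obtain rfl | rfl | ⟨n, rfl⟩ : n = 0 ∨ n = 1 ∨ ∃ l, n = l + 2 := by
    rcases n with _ | _ | n <;> simp
  · obtain ⟨m, rfl⟩ := Nat.exists_eq_add_of_le' (show 4 ≤ m by omega)
    refine exists_lie_of_wronskian (k := m + 1)
      (monomial_mem_I2_sq i j (a := 2) (b := 0) (by omega))
      (monomial_mem_I2_sq i j (a := m + 3) (b := 0) (by omega))
      (by omega) ?_
    simp
    ring
  · obtain ⟨m, rfl⟩ := Nat.exists_eq_add_of_le' (show 3 ≤ m by omega)
    refine exists_lie_of_wronskian (k := m + 2)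
      (monomial_mem_I2_sq i j (a := 1) (b := 1) (by omega))
      (monomial_mem_I2_sq i j (a := m + 3) (b := 0) (by omega))
      (by omega) ?_
    simp [hj]
    ring
  · refine exists_lie_of_wronskian (k := m + 1)
      (monomial_mem_I2_sq i j (a := 0) (b := 2) (by omega))
      (monomial_mem_I2_sq i j (a := m + 1) (b := n) (by omega))
      (by omega) ?_
    simp [hj]
    ring

/-- Every monomial vector field `(z¹)ᵐ(z²)ⁿ∂ᵢ` of total coefficient degree
`m + n ≥ 4` is a bracket of vector fields with vanishing 1-jet. -/
theorem stmt6 (m n : ℕ) (h : 4 ≤ m + n) (i : Fin 2) :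
    ∃ X ∈ L1, ∃ Y ∈ L1, (z1 ^ m * z2 ^ n) • d i = ⁅X, Y⁆ := by
  match i with
  | 0 => exact exists_lie_eq_monomial_smul_d (i := 0) (j := 1) (by decide) m n h
  | 1 =>
    rw [mul_comm (z1 ^ m)]
    exact exists_lie_eq_monomial_smul_d (i := 1) (j := 0) (by decide) n m (by omega)

end
end

section
/- The 2-chain α = z¹Eu ∧ z¹z²Eu − z²Eu ∧ (z¹)²Eu is a Chevalley–Eilenberg 2-cycle for the Lie algebra of ℂ-derivations of ℂ[z¹,z²]: applying the Chevalley–Eilenberg boundary x∧y ↦ ⁅x,y⁆ gives zero, i.e. ⁅z¹Eu, z¹z²Eu⁆ = ⁅z²Eu, (z¹)²Eu⁆ (both sides equal (z¹)²z²Eu), where Eu = z¹∂₁ + z²∂₂ is the Euler derivation. -/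
open MvPolynomial

noncomputable section

def d1 : W2 := pderiv 0
def d2 : W2 := pderiv 1

/-- The Euler derivation `Eu = z¹∂₁ + z²∂₂`. -/
def Eu : W2 := z1 • d1 + z2 • d2

/-- The bracket of two multiples of a derivation `D` is again a multiple of `D`. -/
theorem Derivation.lie_smul_smul_self {R A : Type*} [CommRing R] [CommRing A] [Algebra R A]
    (D : Derivation R A A) (f g : A) : ⁅f • D, g • D⁆ = (f * D g - g * D f) • D := by
  ext a
  simp only [Derivation.commutator_apply, Derivation.smul_apply, smul_eq_mul, Derivation.leibniz]
  ring

theorem Eu_z1 : Eu z1 = z1 := by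
  simp [Eu, z1, z2, d1, d2, pderiv_X]

theorem Eu_z2 : Eu z2 = z2 := by
  simp [Eu, z1, z2, d1, d2, pderiv_X]

/-- The 2-chain `α = z¹Eu ∧ z¹z²Eu − z²Eu ∧ (z¹)²Eu` is a Chevalley–Eilenberg
2-cycle: `⁅z¹Eu, z¹z²Eu⁆ = ⁅z²Eu, (z¹)²Eu⁆`, both sides being `(z¹)²z²Eu`. -/
theorem stmt7 :
    ⁅z1 • Eu, (z1 * z2) • Eu⁆ = ⁅z2 • Eu, z1 ^ 2 • Eu⁆ ∧
    ⁅z1 • Eu, (z1 * z2) • Eu⁆ = (z1 ^ 2 * z2) • Eu := by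
  simp only [Derivation.lie_smul_smul_self, Derivation.leibniz, Derivation.leibniz_pow, Eu_z1,
    Eu_z2, smul_eq_mul, nsmul_eq_mul]
  constructor <;> congr 1 <;> push_cast <;> ring

end
end

section
/- The 2-chain β = 3·(z¹)²∂₂ ∧ (z²)²Eu + 2·((z¹)²∂₁ − 2z¹z²∂₂) ∧ z¹z²Eu − (2z¹z²∂₁ − (z²)²∂₂) ∧ (z¹)²Eu is a Chevalley–Eilenberg 2-cycle for the Lie algebra of ℂ-derivations of ℂ[z¹,z²]: applying the Chevalley–Eilenberg boundary x∧y ↦ ⁅x,y⁆ gives zero, i.e. 3·⁅(z¹)²∂₂, (z²)²Eu⁆ + 2·⁅(z¹)²∂₁ − 2z¹z²∂₂, z¹z²Eu⁆ − ⁅2z¹z²∂₁ − (z²)²∂₂, (z¹)²Eu⁆ = 0, where Eu = z¹∂₁ + z²∂₂ is the Euler derivation. -/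
open MvPolynomial

noncomputable section

/-- The 2-chain
`β = 3·(z¹)²∂₂ ∧ (z²)²Eu + 2·((z¹)²∂₁ − 2z¹z²∂₂) ∧ z¹z²Eu − (2z¹z²∂₁ − (z²)²∂₂) ∧ (z¹)²Eu`
is a Chevalley–Eilenberg 2-cycle: applying `x∧y ↦ ⁅x,y⁆` gives zero. -/
theorem stmt8 :
    (3 : ℂ) • ⁅z1 ^ 2 • d2, z2 ^ 2 • Eu⁆
      + (2 : ℂ) • ⁅z1 ^ 2 • d1 - (2 : ℂ) • ((z1 * z2) • d2), (z1 * z2) • Eu⁆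
      - ⁅(2 : ℂ) • ((z1 * z2) • d1) - z2 ^ 2 • d2, z1 ^ 2 • Eu⁆ = 0 := by
  have h11 : d1 z1 = 1 := pderiv_X_self 0
  have h12 : d1 z2 = 0 := pderiv_X_of_ne (by decide)
  have h21 : d2 z1 = 0 := pderiv_X_of_ne (by decide)
  have h22 : d2 z2 = 1 := pderiv_X_self 1
  have hC : (C (2 : ℂ) : R2) = 2 := map_ofNat C 2
  have hC3 : (C (3 : ℂ) : R2) = 3 := map_ofNat C 3
  have hd (D : W2) : D 2 = 0 := D.map_natCast 2
  apply MvPolynomial.derivation_ext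
  intro i
  have hX : (X i : R2) = z1 ∨ (X i : R2) = z2 := by
    fin_cases i
    · exact Or.inl rfl
    · exact Or.inr rfl
  rcases hX with h | h <;> rw [h] <;>
    simp [Eu, Derivation.commutator_apply, Derivation.leibniz, Derivation.leibniz_pow,
      h11, h12, h21, h22, MvPolynomial.smul_eq_C_mul, hC, hC3, hd] <;> ring

end
end
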